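/- arXiv:2002.07558 — 2 statements merged into one kernel-verified Lean document; each statement's English description precedes it below -/
import Mathlib

section
/- Let C be any set of bounded regular resynchronizers that contains, for every k ∈ ℕ, the k-shift resynchronizer (no input parameters, language γ = {annotated words (u, x, y) : y ≤ x ≤ y + k}). Then it is undecidable, given (codes of) two one-way nondeterministic transducers T₁ and T₂, whether there exists R ∈ C with ⟦T₁⟧ᵒ ⊆ R(⟦T₂⟧ᵒ). -/
/-- An annotated letter over `Σ × {0,1}^(m+2)`: an input letter together with `m`
parameter bits and two marker bits (for the source position `x` and target position `y`). -/
abbrev RLetter (Sig : Type) (m : ℕ) : Type :=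
  Sig × (Fin m → Bool) × Bool × Bool

/-- The word over `Σ × {0,1}^(m+2)` annotating `u` with the parameter valuation `Ī`
(positions are 1-indexed, parameters given by their characteristic functions) and with
marker bits at positions `x` and `y`. -/
def annot {Sig : Type} {m : ℕ} (u : List Sig) (I : Fin m → ℕ → Bool)
    (x y : ℕ) : List (RLetter Sig m) :=
  u.mapIdx fun j a => (a, fun i => I i (j + 1), decide (j + 1 = x), decide (j + 1 = y))

/-- `(u, Ī, x, y) ⊨ γ`. -/
def RSat {Sig : Type} {m : ℕ} (γ : Set (List (RLetter Sig m)))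
    (u : List Sig) (I : Fin m → ℕ → Bool) (x y : ℕ) : Prop :=
  annot u I x y ∈ γ

/-- A language is regular if it is accepted by a deterministic finite automaton. -/
def IsRegularLang {α : Type} (L : Set (List α)) : Prop :=
  ∃ (Q : Type) (_ : Fintype Q) (M : DFA α Q), M.accepts = L

/-- A resynchronizer (given by its language `γ` with `m` input parameters) is bounded by `k`
if for every input word `u`, parameters `Ī` and position `y` of `u`, there are at most `k`
distinct positions `x` of `u` with `(u, Ī, x, y) ⊨ γ`. -/
def BoundedBy {Sig : Type} {m : ℕ} (γ : Set (List (RLetter Sig m))) (k : ℕ) : Prop :=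
  ∀ (u : List Sig) (I : Fin m → ℕ → Bool) (y : ℕ), 1 ≤ y → y ≤ u.length →
    {x : ℕ | 1 ≤ x ∧ x ≤ u.length ∧ RSat γ u I x y}.ncard ≤ k

/-- A resynchronizer is bounded if it is bounded by some `k`. -/
def BoundedResync {Sig : Type} {m : ℕ} (γ : Set (List (RLetter Sig m))) : Prop :=
  ∃ k, BoundedBy γ k

/-- An origin graph: a nonempty input word `u`, an output word `v`, and an origin map
sending every (1-indexed) position of `v` to a position of `u`. -/
structure OriginGraph (Sig Gam : Type) where
  inp : List Sig
  out : List Gam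
  orig : ℕ → ℕ
  inp_ne : inp ≠ []
  orig_mem : ∀ t, 1 ≤ t → t ≤ out.length → 1 ≤ orig t ∧ orig t ≤ inp.length

/-- `(g, g') ∈ ⟦R⟧` for the resynchronizer with language `γ`: same input and output,
and for some choice of input parameters, every output position has its `g`-origin
redirected to its `g'`-origin as allowed by `γ`. -/
def ResyncRel {Sig Gam : Type} {m : ℕ} (γ : Set (List (RLetter Sig m)))
    (g g' : OriginGraph Sig Gam) : Prop :=
  g.inp = g'.inp ∧ g.out = g'.out ∧
    ∃ I : Fin m → ℕ → Bool,
      ∀ z, 1 ≤ z → z ≤ g'.out.length → RSat γ g.inp I (g.orig z) (g'.orig z)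

/-- `S₁ ⊆ R(S₂)` for the resynchronizer with language `γ`. -/
def ContainedUpTo {Sig Gam : Type} {m : ℕ} (γ : Set (List (RLetter Sig m)))
    (S₁ S₂ : Set (OriginGraph Sig Gam)) : Prop :=
  ∀ g₁ ∈ S₁, ∃ g₂ ∈ S₂, ResyncRel γ g₂ g₁

/-- `S₁ ⪯ S₂`: there is a bounded regular resynchronizer `R` with `S₁ ⊆ R(S₂)`. -/
def ResyncLE {Sig Gam : Type} (S₁ S₂ : Set (OriginGraph Sig Gam)) : Prop :=
  ∃ (m : ℕ) (γ : Set (List (RLetter Sig m))),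
    IsRegularLang γ ∧ BoundedResync γ ∧ ContainedUpTo γ S₁ S₂

/-- Input position `x` traverses input position `z` (with respect to the pair `(g, g')`). -/
def Traverses {Sig Gam : Type} (g g' : OriginGraph Sig Gam) (x z : ℕ) : Prop :=
  ∃ t, 1 ≤ t ∧ t ≤ g.out.length ∧ g.orig t = x ∧
    ((x ≤ z ∧ z < g'.orig t) ∨ (g'.orig t < z ∧ z ≤ x))

/-- The pair `(g, g')` has `k`-traversal: every input position `z` is traversed by at
most `k` distinct positions. -/
def HasTraversal {Sig Gam : Type} (k : ℕ) (g g' : OriginGraph Sig Gam) : Prop :=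
  ∀ z, 1 ≤ z → z ≤ g.inp.length → {x : ℕ | Traverses g g' x z}.ncard ≤ k


/-- The language of the `k`-shift resynchronizer (no input parameters): the set of
annotated words `(u, x, y)` with `y ≤ x ≤ y + k`. -/
def shiftGamma (Sig : Type) (k : ℕ) : Set (List (RLetter Sig 0)) :=
  { w | ∃ (u : List Sig) (I : Fin 0 → ℕ → Bool) (x y : ℕ),
      w = annot u I x y ∧ y ≤ x ∧ x ≤ y + k }

/-- A transition of a one-way nondeterministic transducer: source state, input letter
(`none` for an ε-transition), output word, target state. States and letters are
natural numbers. -/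
abbrev NTrans : Type := ℕ × Option ℕ × List ℕ × ℕ

/-- A one-way nondeterministic transducer (1NT), as a finite object: the list of
transitions, the list of initial states and the list of final states. -/
abbrev NT1 : Type := List NTrans × List ℕ × List ℕ

/-- Given the number `c` of input letters consumed so far, compute from a sequence of
transitions the triple (input word, output word, list of origins of the output positions).
The output produced while reading the input letter at position `j` gets origin `j`;
output produced by an ε-transition gets as origin the last input position read so far
(position `1` if no input has been read yet, position `|u|` if the whole input has been
consumed). -/
def runData : ℕ → List NTrans → List ℕ × List ℕ × List ℕ
  | _, [] => ([], [], [])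
  | c, tr :: rest =>
    match tr.2.1 with
    | some a =>
        let r := runData (c + 1) rest
        (a :: r.1, tr.2.2.1 ++ r.2.1, tr.2.2.1.map (fun _ => c + 1) ++ r.2.2)
    | none =>
        let r := runData c rest
        (r.1, tr.2.2.1 ++ r.2.1, tr.2.2.1.map (fun _ => max c 1) ++ r.2.2)

/-- `ts` is (the sequence of transitions of) an accepting run of the 1NT `T`. -/
def IsRun (T : NT1) (ts : List NTrans) : Prop :=
  ts ≠ [] ∧ (∀ tr ∈ ts, tr ∈ T.1) ∧
    (ts.head?.elim False fun tr => tr.1 ∈ T.2.1) ∧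
    (ts.getLast?.elim False fun tr => tr.2.2.2 ∈ T.2.2) ∧
    ts.Chain' (fun s t => s.2.2.2 = t.1)

/-- The origin semantics `⟦T⟧ᵒ` of a 1NT: the set of origin graphs of accepting runs
of `T` (on nonempty inputs). -/
def OSem (T : NT1) : Set (OriginGraph ℕ ℕ) :=
  { g | ∃ ts, IsRun T ts ∧
      g.inp = (runData 0 ts).1 ∧
      g.out = (runData 0 ts).2.1 ∧
      ∀ z, 1 ≤ z → z ≤ g.out.length → g.orig z = ((runData 0 ts).2.2).getD (z - 1) 1 }

/-- `NTAccepts T p c u v os`: from state `p`, after `c` input letters have been consumed, the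
transducer `T` can reach a final state while reading `u` and producing `v` with origins `os`. -/
inductive NTAccepts (T : NT1) : ℕ → ℕ → List ℕ → List ℕ → List ℕ → Prop
  | nil {p c : ℕ} : p ∈ T.2.2 → NTAccepts T p c [] [] []
  | read {p c a q : ℕ} {o u v os : List ℕ} : (p, some a, o, q) ∈ T.1 →
      NTAccepts T q (c + 1) u v os →
      NTAccepts T p c (a :: u) (o ++ v) (o.map (fun _ => c + 1) ++ os)
  | eps {p c q : ℕ} {o u v os : List ℕ} : (p, none, o, q) ∈ T.1 →
      NTAccepts T q c u v os →
      NTAccepts T p c u (o ++ v) (o.map (fun _ => max c 1) ++ os)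

namespace NTAccepts

variable {T : NT1}

theorem of_run : ∀ (ts : List NTrans) (t : NTrans) (c : ℕ), (∀ tr ∈ t :: ts, tr ∈ T.1) →
    ((t :: ts).getLast?.elim False fun tr => tr.2.2.2 ∈ T.2.2) →
    (t :: ts).IsChain (fun s t => s.2.2.2 = t.1) →
    NTAccepts T t.1 c (runData c (t :: ts)).1 (runData c (t :: ts)).2.1
      (runData c (t :: ts)).2.2 := by
  have step : ∀ (t : NTrans) (ts : List NTrans) (c : ℕ), t ∈ T.1 →
      (∀ c, NTAccepts T t.2.2.2 c (runData c ts).1 (runData c ts).2.1 (runData c ts).2.2) →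
      NTAccepts T t.1 c (runData c (t :: ts)).1 (runData c (t :: ts)).2.1
        (runData c (t :: ts)).2.2 := by
    rintro ⟨p, _ | a, o, q⟩ ts c ht h
    · exact eps ht (h c)
    · exact read ht (h (c + 1))
  intro ts
  induction ts with
  | nil =>
    intro t c hmem hlast _
    exact step t [] c (hmem t (by simp)) fun _ => nil (by simpa using hlast)
  | cons s ts ih =>
    intro t c hmem hlast hch
    obtain ⟨h₁, h₂⟩ := List.isChain_cons_cons.1 hch
    refine step t _ c (hmem t (by simp)) fun c' => ?_
    rw [h₁]
    exact ih s c' (fun tr h => hmem tr (List.mem_cons_of_mem _ h))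
      (by simpa [List.getLast?_cons_cons] using hlast) h₂

theorem exists_run {p c : ℕ} {u v os : List ℕ} (h : NTAccepts T p c u v os) :
    ∃ ts : List NTrans, (∀ tr ∈ ts, tr ∈ T.1) ∧ ts.IsChain (fun s t => s.2.2.2 = t.1) ∧
      runData c ts = (u, v, os) ∧
      (ts = [] ∧ p ∈ T.2.2 ∨ (ts.head?.elim False fun tr => tr.1 = p) ∧
        (ts.getLast?.elim False fun tr => tr.2.2.2 ∈ T.2.2)) := by
  have step : ∀ (t : NTrans) (ts : List NTrans), t ∈ T.1 → (∀ tr ∈ ts, tr ∈ T.1) →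
      ts.IsChain (fun s t => s.2.2.2 = t.1) →
      (ts = [] ∧ t.2.2.2 ∈ T.2.2 ∨ (ts.head?.elim False fun tr => tr.1 = t.2.2.2) ∧
        (ts.getLast?.elim False fun tr => tr.2.2.2 ∈ T.2.2)) →
      (∀ tr ∈ t :: ts, tr ∈ T.1) ∧ (t :: ts).IsChain (fun s t => s.2.2.2 = t.1) ∧
        ((t :: ts).getLast?.elim False fun tr => tr.2.2.2 ∈ T.2.2) := by
    intro t ts ht hts hch h
    refine ⟨by simpa using ⟨ht, fun a b c d => hts (a, b, c, d)⟩, ?_, ?_⟩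
    · rcases ts with _ | ⟨s, ts⟩
      · exact List.isChain_singleton _
      · refine List.isChain_cons_cons.2 ⟨?_, hch⟩
        simpa [eq_comm] using h.resolve_left (by simp) |>.1
    · rcases ts with _ | ⟨s, ts⟩
      · simpa using h
      · simpa [List.getLast?_cons_cons] using h.resolve_left (by simp) |>.2
  induction h with
  | nil hp => exact ⟨[], by simp, List.isChain_nil, rfl, Or.inl ⟨rfl, hp⟩⟩
  | @read p c a q o u v os ht _ ih =>
    obtain ⟨ts, h₁, h₂, h₃, h₄⟩ := ih
    obtain ⟨k₁, k₂, k₃⟩ := step _ ts ht h₁ h₂ h₄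
    exact ⟨_, k₁, k₂, by simp [runData, h₃], Or.inr ⟨by simp, k₃⟩⟩
  | @eps p c q o u v os ht _ ih =>
    obtain ⟨ts, h₁, h₂, h₃, h₄⟩ := ih
    obtain ⟨k₁, k₂, k₃⟩ := step _ ts ht h₁ h₂ h₄
    exact ⟨_, k₁, k₂, by simp [runData, h₃], Or.inr ⟨by simp, k₃⟩⟩

theorem length_eq {p c : ℕ} {u v os : List ℕ} (h : NTAccepts T p c u v os) :
    os.length = v.length := by
  induction h <;> simp [*]

end NTAccepts

theorem mem_OSem_iff {T : NT1} {g : OriginGraph ℕ ℕ} :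
    g ∈ OSem T ↔ ∃ p ∈ T.2.1, ∃ os, NTAccepts T p 0 g.inp g.out os ∧
      ∀ z, 1 ≤ z → z ≤ g.out.length → g.orig z = os.getD (z - 1) 1 := by
  constructor
  · rintro ⟨ts, ⟨hne, hmem, hhead, hlast, hch⟩, hi, ho, hz⟩
    rcases ts with _ | ⟨t, ts⟩
    · exact absurd rfl hne
    · refine ⟨t.1, by simpa using hhead, _, ?_, hz⟩
      rw [hi, ho]
      exact NTAccepts.of_run ts t 0 hmem hlast hch
  · rintro ⟨p, hp, os, hacc, hz⟩
    obtain ⟨ts, h₁, h₂, h₃, h₄⟩ := hacc.exists_run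
    have hne : ts ≠ [] := by
      rintro rfl
      exact g.inp_ne (by simpa [runData] using (congrArg Prod.fst h₃).symm)
    obtain ⟨h₅, h₆⟩ := h₄.resolve_left fun h => hne h.1
    refine ⟨ts, ⟨hne, h₁, ?_, h₆, h₂⟩, by rw [h₃], by rw [h₃], by rw [h₃]; exact hz⟩
    rcases ts with _ | ⟨t, ts⟩
    · exact absurd rfl hne
    · have : t.1 = p := by simpa using h₅
      simpa [this] using hp

/-- The transducer reading an arbitrary nonempty word over `{0, …, m - 1}` and producing an
arbitrary word over `{0, …, m - 1}`, entirely with origin `1`. -/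
def burstNT (m : ℕ) : NT1 :=
  ((List.range m).map (fun b => (0, none, [b], 0)) ++
    (List.range m).flatMap (fun a => [(0, some a, [], 1), (1, some a, [], 1)]), [0], [1])

section burst

variable {m : ℕ}

theorem mem_burstNT {p q : ℕ} {x : Option ℕ} {o : List ℕ} :
    (p, x, o, q) ∈ (burstNT m).1 ↔ (∃ b < m, p = 0 ∧ x = none ∧ o = [b] ∧ q = 0) ∨
      ∃ a < m, (p = 0 ∨ p = 1) ∧ x = some a ∧ o = [] ∧ q = 1 := by
  simp only [burstNT, List.mem_append, List.mem_map, List.mem_range, List.mem_flatMap,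
    List.mem_cons, List.not_mem_nil, or_false, Prod.mk.injEq]
  grind

theorem burstNT_accepts {u v : List ℕ} (hne : u ≠ []) (hu : ∀ a ∈ u, a < m)
    (hv : ∀ b ∈ v, b < m) : NTAccepts (burstNT m) 0 0 u v (v.map fun _ => 1) := by
  have h1 : ∀ (u : List ℕ) (c : ℕ), (∀ a ∈ u, a < m) → NTAccepts (burstNT m) 1 c u [] [] := by
    intro u
    induction u with
    | nil => exact fun c _ => .nil (by simp [burstNT])
    | cons a u ih =>
      intro c hu
      exact .read (o := []) (mem_burstNT.2 (Or.inr ⟨a, hu a (by simp), by simp⟩))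
        (ih _ fun b hb => hu b (by simp [hb]))
  induction v with
  | nil =>
    obtain ⟨a, u, rfl⟩ := List.exists_cons_of_ne_nil hne
    exact .read (o := []) (mem_burstNT.2 (Or.inr ⟨a, hu a (by simp), by simp⟩))
      (h1 _ _ fun b hb => hu b (by simp [hb]))
  | cons b v ih =>
    exact .eps (o := [b]) (mem_burstNT.2 (Or.inl ⟨b, hv b (by simp), by simp⟩))
      (ih fun b hb => hv b (by simp [hb]))

theorem burstNT_sound {u v os : List ℕ} (h : NTAccepts (burstNT m) 0 0 u v os) :
    (∀ a ∈ u, a < m) ∧ (∀ b ∈ v, b < m) ∧ ∀ x ∈ os, x = 1 := by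
  have key : ∀ {p c : ℕ} {u v os : List ℕ}, NTAccepts (burstNT m) p c u v os →
      (∀ a ∈ u, a < m) ∧ (∀ b ∈ v, b < m) ∧ (p = 1 → v = []) ∧ (c = 0 → ∀ x ∈ os, x = 1) := by
    intro p c u v os h
    induction h with
    | nil => simp
    | read ht ha ih =>
      have hl := ha.length_eq
      rw [mem_burstNT] at ht
      obtain ⟨ih₁, ih₂, ih₃, -⟩ := ih
      obtain ⟨b, hb, -, h, -⟩ | ⟨a, ham, hp, h, rfl, rfl⟩ := ht
      · simp at h
      · cases h
        have := ih₃ rfl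
        subst this
        rw [List.length_nil, List.length_eq_zero_iff] at hl
        subst hl
        simpa [ham] using ih₁
    | eps ht _ ih =>
      rw [mem_burstNT] at ht
      obtain ⟨ih₁, ih₂, ih₃, ih₄⟩ := ih
      obtain ⟨b, hb, rfl, -, rfl, rfl⟩ | ⟨a, ham, hp, h, -⟩ := ht
      · refine ⟨ih₁, by simpa [hb] using ih₂, by simp, ?_⟩
        rintro rfl
        simpa using ih₄ rfl
      · simp at h
  obtain ⟨h₁, h₂, -, h₃⟩ := key h
  exact ⟨h₁, h₂, h₃ rfl⟩

end burst

/-- The transitions from `p` to `q` producing `o` on `x`, together with the transitions producing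
only a proper initial segment of `o` and moving to the state recording the first letter left out. -/
def emit (p : ℕ) (x : Option ℕ) (o : List ℕ) (q : ℕ) : List NTrans :=
  (p, x, o, q) :: (List.range o.length).map fun i => (p, x, o.take i, 4 + 2 * o.getD i 0)

/-- The transitions of `guessNT` that do not depend on the initial words. State `5 + 2 * q` follows
state `q` of the sequential machine `δ`; state `4 + 2 * c` must not produce `c` next; in state `1`
arbitrary output is produced, in state `2` likewise but after the end of the input; in state `0`
the rest of the input is read without output. -/
def guessCore (N m : ℕ) (δ : ℕ → ℕ → Option (ℕ × List ℕ)) : List NTrans :=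
  (List.range m).map (fun a => (0, some a, [], 0)) ++
  (List.range m).flatMap (fun b => [(1, none, [b], 1), (2, none, [b], 2)]) ++
  [(1, none, [], 0)] ++
  (List.range m).flatMap (fun c => (4 + 2 * c, none, [], 0) ::
    ((List.range m).filter (· ≠ c)).map fun b => (4 + 2 * c, none, [b], 1)) ++
  (List.range N).flatMap fun q => (5 + 2 * q, none, [], 2) :: (List.range m).flatMap fun a =>
    (δ q a).elim [(5 + 2 * q, some a, [], 1)] fun r =>
      emit (5 + 2 * q) (some a) r.2 (5 + 2 * r.1)

/-- The transducer that, starting from one of the pairs in `ini` of an initial output and a state of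
the sequential machine `δ`, follows `δ` until the output deviates from that of `δ`, or `δ` stops,
or the input ends. -/
def guessNT (N m : ℕ) (δ : ℕ → ℕ → Option (ℕ × List ℕ)) (ini : List (List ℕ × ℕ)) : NT1 :=
  (ini.flatMap (fun r => emit 3 none r.1 (5 + 2 * r.2)) ++ guessCore N m δ, [3], [0, 2])

/-- The output of the sequential machine `δ` on a word, if `δ` does not stop. -/
def seqOut (δ : ℕ → ℕ → Option (ℕ × List ℕ)) : ℕ → List ℕ → Option (List ℕ)
  | _, [] => some []
  | q, a :: u => (δ q a).bind fun r => (seqOut δ r.1 u).map (r.2 ++ ·)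

theorem mem_emit {p q p' q' : ℕ} {x x' : Option ℕ} {o o' : List ℕ} :
    (p', x', o', q') ∈ emit p x o q ↔ p' = p ∧ x' = x ∧ (o' = o ∧ q' = q ∨
      ∃ i < o.length, o' = o.take i ∧ q' = 4 + 2 * o.getD i 0) := by
  simp only [emit, List.mem_cons, List.mem_map, List.mem_range, Prod.mk.injEq]
  grind

theorem mem_guessNT {N m : ℕ} {δ : ℕ → ℕ → Option (ℕ × List ℕ)} {ini : List (List ℕ × ℕ)}
    {p q : ℕ} {x : Option ℕ} {o : List ℕ} :
    (p, x, o, q) ∈ (guessNT N m δ ini).1 ↔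
      (∃ r ∈ ini, (p, x, o, q) ∈ emit 3 none r.1 (5 + 2 * r.2)) ∨
      (p = 0 ∧ (∃ a < m, x = some a) ∧ o = [] ∧ q = 0) ∨
      ((p = 1 ∨ p = 2) ∧ x = none ∧ (∃ b < m, o = [b]) ∧ q = p) ∨
      (p = 1 ∧ x = none ∧ o = [] ∧ q = 0) ∨
      (∃ c < m, p = 4 + 2 * c ∧ x = none ∧
        (o = [] ∧ q = 0 ∨ ∃ b < m, b ≠ c ∧ o = [b] ∧ q = 1)) ∨
      (∃ r < N, p = 5 + 2 * r ∧ (x = none ∧ o = [] ∧ q = 2 ∨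
        ∃ a < m, (δ r a = none ∧ x = some a ∧ o = [] ∧ q = 1) ∨
          ∃ r' o', δ r a = some (r', o') ∧ (p, x, o, q) ∈ emit p (some a) o' (5 + 2 * r'))) := by
  have hcore : ∀ r a, (p, x, o, q) ∈ ((δ r a).elim [(5 + 2 * r, some a, [], 1)] fun s =>
      emit (5 + 2 * r) (some a) s.2 (5 + 2 * s.1)) ↔ p = 5 + 2 * r ∧
        ((δ r a = none ∧ x = some a ∧ o = [] ∧ q = 1) ∨
          ∃ r' o', δ r a = some (r', o') ∧ (p, x, o, q) ∈ emit p (some a) o' (5 + 2 * r')) := by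
    intro r a
    rcases h : δ r a with _ | ⟨r', o'⟩
    · simp
    · simp only [Option.elim, mem_emit]
      grind
  simp only [guessNT, guessCore, List.mem_append, List.mem_flatMap, List.mem_map, List.mem_range,
    List.mem_cons, List.not_mem_nil, or_false, Prod.mk.injEq, List.mem_filter, decide_eq_true_eq,
    hcore, or_assoc]
  refine or_congr Iff.rfl (or_congr ?_ (or_congr ?_ (or_congr ?_ (or_congr ?_ ?_))))
  · grind
  · grind
  · grind
  · refine exists_congr fun c => and_congr_right fun _ => ?_
    constructor
    · rintro (⟨rfl, rfl, rfl, rfl⟩ | ⟨b, ⟨hb, hbc⟩, rfl, rfl, rfl, rfl⟩)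
      · simp
      · exact ⟨rfl, rfl, Or.inr ⟨b, hb, by simpa using hbc, rfl, rfl⟩⟩
    · rintro ⟨rfl, rfl, ⟨rfl, rfl⟩ | ⟨b, hb, hbc, rfl, rfl⟩⟩
      · simp
      · exact Or.inr ⟨b, ⟨hb, by simpa using hbc⟩, rfl, rfl, rfl, rfl⟩
  · refine exists_congr fun r => and_congr_right fun _ => ?_
    constructor
    · rintro (⟨rfl, rfl, rfl, rfl⟩ | ⟨a, ha, rfl, h⟩)
      · simp
      · exact ⟨rfl, Or.inr ⟨a, ha, h⟩⟩
    · rintro ⟨rfl, ⟨rfl, rfl, rfl⟩ | ⟨a, ha, h⟩⟩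
      · simp
      · exact Or.inr ⟨a, ha, rfl, h⟩

namespace NTAccepts

theorem mem_orig {T : NT1} {p c : ℕ} {u v os : List ℕ} (h : NTAccepts T p c u v os) :
    ∀ x ∈ os, 1 ≤ x ∧ x ≤ max (c + u.length) 1 := by
  induction h with
  | nil => simp
  | read _ _ ih =>
    intro x hx
    simp only [List.mem_append, List.mem_map, List.length_cons] at hx ⊢
    rcases hx with ⟨_, _, rfl⟩ | hx
    · omega
    · have := ih x hx
      omega
  | eps _ _ ih =>
    intro x hx
    simp only [List.mem_append, List.mem_map] at hx ⊢
    rcases hx with ⟨_, _, rfl⟩ | hx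
    · omega
    · exact ih x hx

end NTAccepts

section guess

variable {N m : ℕ} {δ : ℕ → ℕ → Option (ℕ × List ℕ)} {ini : List (List ℕ × ℕ)}

theorem guessNT_dead_out {c : ℕ} {u v os : List ℕ} (h : NTAccepts (guessNT N m δ ini) 0 c u v os) :
    v = [] := by
  generalize hp : 0 = p at h
  induction h with
  | nil => rfl
  | read ht _ ih =>
    simp only [mem_guessNT, mem_emit] at ht
    obtain ⟨_, _, h, _⟩ | ⟨_, _, rfl, rfl⟩ | ⟨h, _⟩ | ⟨h, _⟩ | ⟨_, _, h, _⟩ | ⟨_, _, h, _⟩ := ht <;>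
      first | omega | simp [ih rfl]
  | eps ht _ ih =>
    simp only [mem_guessNT, mem_emit] at ht
    obtain ⟨_, _, h, _⟩ | ⟨_, _, rfl, rfl⟩ | ⟨h, _⟩ | ⟨h, _⟩ | ⟨_, _, h, _⟩ | ⟨_, _, h, _⟩ := ht <;>
      first | omega | simp [ih rfl]

theorem guessNT_tail_inp {c : ℕ} {u v os : List ℕ} (h : NTAccepts (guessNT N m δ ini) 2 c u v os) :
    u = [] := by
  generalize hp : 2 = p at h
  induction h with
  | nil => rfl
  | read ht _ ih =>
    simp only [mem_guessNT, mem_emit] at ht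
    obtain ⟨_, _, h, _⟩ | ⟨_, _, rfl, rfl⟩ | ⟨_, h, _⟩ | ⟨h, _⟩ | ⟨_, _, h, _⟩ | ⟨_, _, h, _⟩ := ht <;>
      first | omega | simp at h
  | eps ht _ ih =>
    simp only [mem_guessNT, mem_emit] at ht
    obtain ⟨_, _, h, _⟩ | ⟨_, _, rfl, rfl⟩ | ⟨_, _, _, h⟩ | ⟨h, _⟩ | ⟨_, _, h, _⟩ | ⟨_, _, h, _⟩ := ht <;>
      first | omega | exact ih (by omega)

theorem guessNT_err_out {c d : ℕ} {u v os : List ℕ}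
    (h : NTAccepts (guessNT N m δ ini) (4 + 2 * d) c u v os) : v.head? ≠ some d := by
  cases h with
  | nil => simp
  | read ht _ =>
    simp only [mem_guessNT, mem_emit] at ht
    obtain ⟨_, _, h, _⟩ | ⟨h, _⟩ | ⟨h, _⟩ | ⟨h, _⟩ | ⟨_, _, _, h, _⟩ | ⟨_, _, h, _⟩ := ht <;>
      first | omega | simp at h
  | eps ht ha =>
    simp only [mem_guessNT, mem_emit] at ht
    obtain ⟨_, _, h, _⟩ | ⟨h, _⟩ | ⟨h, _⟩ | ⟨h, _⟩ |
      ⟨e, _, he, _, ⟨rfl, rfl⟩ | ⟨b, _, hb, rfl, _⟩⟩ | ⟨_, _, h, _⟩ := ht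
    any_goals omega
    · simp [guessNT_dead_out ha]
    · have : d = e := by omega
      simpa [this] using hb

theorem head?_of_append_take {o v x : List ℕ} {i : ℕ} (hi : i < o.length)
    (h : o ++ x <+: o.take i ++ v) : v.head? = some (o.getD i 0) := by
  obtain ⟨y, hy⟩ := h
  nth_rw 1 [← List.take_append_drop i o] at hy
  rw [List.append_assoc, List.append_assoc, List.append_cancel_left_eq] at hy
  rw [← hy, List.drop_eq_getElem_cons hi]
  simp [hi]

theorem guessNT_run_sound (hne : ∀ q a q' o, δ q a = some (q', o) → o ≠ []) {u : List ℕ} :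
    ∀ {q c : ℕ} {v os o : List ℕ}, NTAccepts (guessNT N m δ ini) (5 + 2 * q) c u v os →
      seqOut δ q u = some o → o <+: v → ∀ j, c < j → j ≤ c + u.length → j ∈ os := by
  induction u with
  | nil => intro q c v os o _ _ _ j h₁ h₂; simp at h₂; omega
  | cons a u ih =>
    intro q c v os o h ho hpre j h₁ h₂
    simp only [seqOut, Option.bind_eq_some_iff, Option.map_eq_some_iff, Prod.exists] at ho
    obtain ⟨r, o₁, hδ, o₂, ho₂, rfl⟩ := ho
    cases h with
    | read ht ha =>
      simp only [mem_guessNT, mem_emit] at ht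
      obtain ⟨_, _, h, _⟩ | ⟨h, _⟩ | ⟨h, _⟩ | ⟨h, _⟩ | ⟨_, _, h, _⟩ |
        ⟨s, _, hs, ⟨h, _⟩ | ⟨b, _, ⟨hn, h, _⟩ | ⟨r', o', hδ', -, hb, h⟩⟩⟩ := ht
      any_goals omega
      · simp at h
      · obtain rfl : q = s := by omega
        cases h
        simp [hδ] at hn
      · obtain rfl : q = s := by omega
        cases hb
        rw [hδ] at hδ'
        cases hδ'
        obtain ⟨rfl, rfl⟩ | ⟨i, hi, rfl, rfl⟩ := h
        · rw [List.prefix_append_right_inj] at hpre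
          by_cases hj : j = c + 1
          · subst hj
            obtain ⟨b, o, rfl⟩ := List.exists_cons_of_ne_nil (hne _ _ _ _ hδ)
            simp
          · refine List.mem_append_right _ (ih ha ho₂ hpre j (by omega) ?_)
            simp at h₂
            omega
        · exact absurd (head?_of_append_take hi hpre) (guessNT_err_out ha)
    | eps ht ha =>
      simp only [mem_guessNT, mem_emit] at ht
      obtain ⟨_, _, h, _⟩ | ⟨h, _⟩ | ⟨h, _⟩ | ⟨h, _⟩ | ⟨_, _, h, _⟩ |
        ⟨s, _, hs, ⟨_, _, rfl⟩ | ⟨b, _, ⟨hn, h, _⟩ | ⟨r', o', hδ', -, hb, h⟩⟩⟩ := ht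
      any_goals omega
      · simpa using guessNT_tail_inp ha
      · simp at h
      · simp at hb

theorem guessNT_start_sound (hne : ∀ q a q' o, δ q a = some (q', o) → o ≠ []) {u v os : List ℕ}
    (hu : u ≠ []) (h : NTAccepts (guessNT N m δ ini) 3 0 u v os)
    (hini : ∀ r ∈ ini, ∃ o, seqOut δ r.2 u = some o ∧ r.1 ++ o <+: v) :
    ∀ j, 1 ≤ j → j ≤ u.length → j ∈ os := by
  intro j h₁ h₂
  cases h with
  | nil => exact absurd rfl hu
  | read ht ha =>
    simp only [mem_guessNT, mem_emit] at ht
    obtain ⟨_, _, _, h, _⟩ | ⟨h, _⟩ | ⟨h, _⟩ | ⟨h, _⟩ | ⟨_, _, h, _⟩ | ⟨s, _, hs, _⟩ := ht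
    any_goals omega
    simp at h
  | eps ht ha =>
    simp only [mem_guessNT, mem_emit] at ht
    obtain ⟨⟨w, q⟩, hr, -, -, h⟩ | ⟨h, _⟩ | ⟨h, _⟩ | ⟨h, _⟩ | ⟨_, _, h, _⟩ | ⟨s, _, hs, _⟩ := ht
    any_goals omega
    obtain ⟨o, ho, hpre⟩ := hini _ hr
    obtain ⟨rfl, rfl⟩ | ⟨i, hi, rfl, rfl⟩ := h
    · rw [List.prefix_append_right_inj] at hpre
      exact List.mem_append_right _ (guessNT_run_sound hne ha ho hpre j (by omega) (by omega))
    · exact absurd (head?_of_append_take hi hpre) (guessNT_err_out ha)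

theorem guessNT_dead_accepts {u : List ℕ} (hu : ∀ a ∈ u, a < m) (c : ℕ) :
    NTAccepts (guessNT N m δ ini) 0 c u [] [] := by
  induction u generalizing c with
  | nil => exact .nil (by simp [guessNT])
  | cons a u ih =>
    exact .read (o := []) (mem_guessNT.2 (Or.inr (Or.inl ⟨rfl, ⟨a, hu a (by simp), rfl⟩, rfl, rfl⟩)))
      (ih (fun b hb => hu b (by simp [hb])) _)

theorem guessNT_free_accepts {u v : List ℕ} (hu : ∀ a ∈ u, a < m) (hv : ∀ b ∈ v, b < m) (c : ℕ) :
    NTAccepts (guessNT N m δ ini) 1 c u v (v.map fun _ => max c 1) := by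
  induction v with
  | nil =>
    exact .eps (o := []) (mem_guessNT.2 (Or.inr (Or.inr (Or.inr (Or.inl ⟨rfl, rfl, rfl, rfl⟩)))))
      (guessNT_dead_accepts hu _)
  | cons b v ih =>
    exact .eps (o := [b]) (mem_guessNT.2 (Or.inr (Or.inr (Or.inl
      ⟨Or.inl rfl, rfl, ⟨b, hv b (by simp), rfl⟩, rfl⟩)))) (ih fun b hb => hv b (by simp [hb]))

theorem guessNT_tail_accepts {v : List ℕ} (hv : ∀ b ∈ v, b < m) (c : ℕ) :
    NTAccepts (guessNT N m δ ini) 2 c [] v (v.map fun _ => max c 1) := by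
  induction v with
  | nil => exact .nil (by simp [guessNT])
  | cons b v ih =>
    exact .eps (o := [b]) (mem_guessNT.2 (Or.inr (Or.inr (Or.inl
      ⟨Or.inr rfl, rfl, ⟨b, hv b (by simp), rfl⟩, rfl⟩)))) (ih fun b hb => hv b (by simp [hb]))

theorem guessNT_err_accepts {d : ℕ} (hd : d < m) {u v : List ℕ} (hu : ∀ a ∈ u, a < m)
    (hv : ∀ b ∈ v, b < m) (hh : v.head? ≠ some d) (c : ℕ) :
    NTAccepts (guessNT N m δ ini) (4 + 2 * d) c u v (v.map fun _ => max c 1) := by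
  rcases v with _ | ⟨b, v⟩
  · exact .eps (o := []) (mem_guessNT.2 (Or.inr (Or.inr (Or.inr (Or.inr (Or.inl
      ⟨d, hd, rfl, rfl, Or.inl ⟨rfl, rfl⟩⟩)))))) (guessNT_dead_accepts hu _)
  · exact .eps (o := [b]) (mem_guessNT.2 (Or.inr (Or.inr (Or.inr (Or.inr (Or.inl
      ⟨d, hd, rfl, rfl, Or.inr ⟨b, hv b (by simp), by simpa using hh, rfl, rfl⟩⟩))))))
      (guessNT_free_accepts hu (fun b hb => hv b (by simp [hb])) _)

theorem exists_mismatch {o : List ℕ} : ∀ {v : List ℕ}, ¬ o <+: v →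
    ∃ i < o.length, ∃ v', v = o.take i ++ v' ∧ v'.head? ≠ some (o.getD i 0) := by
  induction o with
  | nil => intro v h; simp at h
  | cons a o ih =>
    intro v h
    by_cases hh : v.head? = some a
    · obtain ⟨v, rfl⟩ := List.head?_eq_some_iff.1 hh
      obtain ⟨i, hi, v', rfl, hv'⟩ := ih fun h' => h ((List.prefix_cons_inj a).2 h')
      exact ⟨i + 1, by simpa using hi, v', by simp, by simpa using hv'⟩
    · exact ⟨0, by simp, v, by simp, by simpa using hh⟩

theorem guessNT_run_complete
    (hcl : ∀ q a q' o, q < N → a < m → δ q a = some (q', o) → q' < N ∧ ∀ b ∈ o, b < m)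
    {u₁ : List ℕ} : ∀ {q c : ℕ} {u₂ v : List ℕ}, q < N → (∀ a ∈ u₁, a < m) → (∀ a ∈ u₂, a < m) →
      (∀ b ∈ v, b < m) → (u₂ = [] ∨ ∀ o, seqOut δ q u₁ = some o → ¬ o <+: v) →
      ∃ os, NTAccepts (guessNT N m δ ini) (5 + 2 * q) c (u₁ ++ u₂) v os ∧
        ∀ x ∈ os, x ≤ max (c + u₁.length) 1 := by
  induction u₁ with
  | nil =>
    intro q c u₂ v hq _ hu₂ hv h
    obtain rfl | h := h
    · refine ⟨_, .eps (o := []) (mem_guessNT.2 (Or.inr (Or.inr (Or.inr (Or.inr (Or.inr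
        ⟨q, hq, rfl, Or.inl ⟨rfl, rfl, rfl⟩⟩)))))) (guessNT_tail_accepts hv _), ?_⟩
      simp only [List.map_nil, List.nil_append, List.mem_map, List.length_nil]
      rintro x ⟨_, _, rfl⟩
      omega
    · exact absurd (by simp) (h [] rfl)
  | cons a u₁ ih =>
    intro q c u₂ v hq hu₁ hu₂ hv h
    have ha : a < m := hu₁ a (by simp)
    have hu₁' : ∀ b ∈ u₁, b < m := fun b hb => hu₁ b (by simp [hb])
    have hu : ∀ b ∈ u₁ ++ u₂, b < m := fun b hb =>
      (List.mem_append.1 hb).elim (hu₁' b) (hu₂ b)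
    rcases hδ : δ q a with _ | ⟨r, o⟩
    · refine ⟨_, .read (o := []) (mem_guessNT.2 (Or.inr (Or.inr (Or.inr (Or.inr (Or.inr
        ⟨q, hq, rfl, Or.inr ⟨a, ha, Or.inl ⟨hδ, rfl, rfl, rfl⟩⟩⟩))))))
        (guessNT_free_accepts hu hv _), ?_⟩
      simp only [List.map_nil, List.nil_append, List.mem_map, List.length_cons]
      rintro x ⟨_, _, rfl⟩
      omega
    · obtain ⟨hr, ho⟩ := hcl q a r o hq ha hδ
      by_cases hpre : o <+: v
      · obtain ⟨v, rfl⟩ := hpre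
        obtain ⟨os, hos, hle⟩ := ih (c := c + 1) (v := v) hr hu₁' hu₂
          (fun b hb => hv b (by simp [hb])) (h.imp_right fun h' o₂ ho₂ hp => by
            refine h' (o ++ o₂) (by simp [seqOut, hδ, ho₂]) ?_
            rwa [List.prefix_append_right_inj])
        refine ⟨_, .read (mem_guessNT.2 (Or.inr (Or.inr (Or.inr (Or.inr (Or.inr
          ⟨q, hq, rfl, Or.inr ⟨a, ha, Or.inr ⟨r, o, hδ, mem_emit.2
            ⟨rfl, rfl, Or.inl ⟨rfl, rfl⟩⟩⟩⟩⟩)))))) hos, fun x hx => ?_⟩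
        simp only [List.mem_append, List.mem_map, List.length_cons] at hx ⊢
        rcases hx with ⟨_, _, rfl⟩ | hx
        · omega
        · have := hle x hx
          omega
      · obtain ⟨i, hi, v', rfl, hv'⟩ := exists_mismatch hpre
        refine ⟨_, .read (mem_guessNT.2 (Or.inr (Or.inr (Or.inr (Or.inr (Or.inr
          ⟨q, hq, rfl, Or.inr ⟨a, ha, Or.inr ⟨r, o, hδ, mem_emit.2
            ⟨rfl, rfl, Or.inr ⟨i, hi, rfl, rfl⟩⟩⟩⟩⟩))))))
          (guessNT_err_accepts (ho _ (by simp [hi])) hu (fun b hb => hv b (by simp [hb])) hv' _),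
          fun x hx => ?_⟩
        simp only [List.mem_append, List.mem_map, List.length_cons] at hx ⊢
        rcases hx with ⟨_, _, rfl⟩ | ⟨_, _, rfl⟩ <;> omega

theorem guessNT_start_complete
    (hcl : ∀ q a q' o, q < N → a < m → δ q a = some (q', o) → q' < N ∧ ∀ b ∈ o, b < m)
    {w : List ℕ} {q : ℕ} (hr : (w, q) ∈ ini) (hw : ∀ b ∈ w, b < m) (hq : q < N)
    {u₁ u₂ v : List ℕ} (hu₁ : ∀ a ∈ u₁, a < m) (hu₂ : ∀ a ∈ u₂, a < m) (hv : ∀ b ∈ v, b < m)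
    (h : u₂ = [] ∨ ∀ o, seqOut δ q u₁ = some o → ¬ w ++ o <+: v) :
    ∃ os, NTAccepts (guessNT N m δ ini) 3 0 (u₁ ++ u₂) v os ∧ ∀ x ∈ os, x ≤ max u₁.length 1 := by
  by_cases hpre : w <+: v
  · obtain ⟨v, rfl⟩ := hpre
    obtain ⟨os, hos, hle⟩ := guessNT_run_complete (ini := ini) (c := 0) (v := v) hcl hq hu₁ hu₂
      (fun b hb => hv b (by simp [hb]))
      (h.imp_right fun h' o ho hp => h' o ho (by rwa [List.prefix_append_right_inj]))
    refine ⟨_, .eps (mem_guessNT.2 (Or.inl ⟨_, hr, mem_emit.2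
      ⟨rfl, rfl, Or.inl ⟨rfl, rfl⟩⟩⟩)) hos, fun x hx => ?_⟩
    simp only [List.mem_append, List.mem_map] at hx ⊢
    rcases hx with ⟨_, _, rfl⟩ | hx
    · omega
    · simpa using hle x hx
  · obtain ⟨i, hi, v', rfl, hv'⟩ := exists_mismatch hpre
    refine ⟨_, .eps (mem_guessNT.2 (Or.inl ⟨_, hr, mem_emit.2
      ⟨rfl, rfl, Or.inr ⟨i, hi, rfl, rfl⟩⟩⟩))
      (guessNT_err_accepts (hw _ (by simp [hi])) (fun a ha => ?_)
        (fun b hb => hv b (by simp [hb])) hv' _), fun x hx => ?_⟩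
    · exact (List.mem_append.1 ha).elim (hu₁ a) (hu₂ a)
    · simp only [List.mem_append, List.mem_map] at hx ⊢
      rcases hx with ⟨_, _, rfl⟩ | ⟨_, _, rfl⟩ <;> omega

end guess

/-- `Lasts f n a`: at least `n` steps of `f` can be made from `a`. -/
def Lasts {σ : Type} (f : σ → Option σ) : ℕ → σ → Prop
  | 0, _ => True
  | n + 1, a => ∃ b, f a = some b ∧ Lasts f n b

theorem eval_dom_iff_exists_not_lasts {σ : Type} (f : σ → Option σ) (a : σ) :
    (StateTransition.eval f a).Dom ↔ ∃ n, ¬ Lasts f n a := by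
  constructor
  · intro h
    obtain ⟨hr, hn⟩ := StateTransition.mem_eval.1 (Part.get_mem h)
    generalize (StateTransition.eval f a).get h = b at hr hn
    clear h
    induction hr using Relation.ReflTransGen.head_induction_on with
    | refl => exact ⟨1, by rintro ⟨c, hc, -⟩; simp [hn] at hc⟩
    | head hs _ ih =>
      obtain ⟨n, hl⟩ := ih
      refine ⟨n + 1, ?_⟩
      rintro ⟨c, hc, hc'⟩
      rw [Option.mem_def, hc] at hs
      cases hs
      exact hl hc'
  · rintro ⟨n, hn⟩
    induction n generalizing a with
    | zero => exact absurd trivial hn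
    | succ n ih =>
      rcases h : f a with _ | b
      · exact Part.dom_iff_mem.2 ⟨a, StateTransition.mem_eval.2 ⟨.refl, h⟩⟩
      · rw [StateTransition.reaches_eval (b := b) (.single h)]
        exact ih b fun hl => hn ⟨b, h, hl⟩

/-- The step function of the queue machine with transition function `δ`: the first letter of the
queue is consumed, and the word produced is appended. -/
def queueStep {Q A : Type} (δ : Q → A → Option (Q × List A)) : Q × List A → Option (Q × List A)
  | (_, []) => none
  | (q, a :: x) => (δ q a).map fun r => (r.1, x ++ r.2)

section queue

variable {N m : ℕ} {δ : ℕ → ℕ → Option (ℕ × List ℕ)}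

theorem lasts_of_seqOut (hne : ∀ q a q' o, δ q a = some (q', o) → o ≠ []) {u : List ℕ} :
    ∀ {q : ℕ} {x o v : List ℕ}, x ≠ [] → seqOut δ q u = some o → x ++ o <+: v → u <+: v →
      Lasts (queueStep δ) u.length (q, x) := by
  induction u with
  | nil => intros; trivial
  | cons a u ih =>
    intro q x o v hx ho hpre hu
    simp only [seqOut, Option.bind_eq_some_iff, Option.map_eq_some_iff, Prod.exists] at ho
    obtain ⟨r, o₁, hδ, o₂, ho₂, rfl⟩ := ho
    obtain ⟨b, x, rfl⟩ := List.exists_cons_of_ne_nil hx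
    obtain ⟨v, rfl⟩ := hu
    simp only [List.cons_append, List.cons_prefix_cons] at hpre
    obtain ⟨rfl, hpre⟩ := hpre
    refine ⟨(r, x ++ o₁), by simp [queueStep, hδ], ih (o := o₂) (v := u ++ v) ?_ ho₂ ?_ ?_⟩
    · simp [hne _ _ _ _ hδ]
    · simpa using hpre
    · simp

theorem exists_seqOut_of_lasts
    (hcl : ∀ q a q' o, q < N → a < m → δ q a = some (q', o) → q' < N ∧ ∀ b ∈ o, b < m) {n : ℕ} :
    ∀ {q : ℕ} {x : List ℕ}, q < N → (∀ b ∈ x, b < m) → Lasts (queueStep δ) n (q, x) →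
      ∃ u o y, u.length = n ∧ seqOut δ q u = some o ∧ x ++ o = u ++ y ∧ ∀ b ∈ u ++ y, b < m := by
  induction n with
  | zero => exact fun {q x} _ hx _ => ⟨[], [], x, rfl, rfl, by simp, by simpa using hx⟩
  | succ n ih =>
    rintro q (_ | ⟨a, x⟩) hq hx ⟨b, hb, hl⟩
    · simp [queueStep] at hb
    · simp only [queueStep, Option.map_eq_some_iff, Prod.exists] at hb
      obtain ⟨r, o, hδ, rfl⟩ := hb
      have ha : a < m := hx a (by simp)
      obtain ⟨hr, ho⟩ := hcl _ _ _ _ hq ha hδ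
      obtain ⟨u, o', y, hu, ho', he, hb⟩ := ih (x := x ++ o) hr (fun b hb =>
        (List.mem_append.1 hb).elim (fun h => hx b (by simp [h])) (ho b)) hl
      refine ⟨a :: u, o ++ o', y, by simp [hu], by simp [seqOut, hδ, ho'], by simpa using he, ?_⟩
      simpa [ha] using hb

theorem seqOut_copy (hid : ∀ a < m, δ 0 a = some (0, [a])) {u : List ℕ} (hu : ∀ a ∈ u, a < m) :
    seqOut δ 0 u = some u := by
  induction u with
  | nil => rfl
  | cons a u ih => simp [seqOut, hid a (hu a (by simp)), ih fun b hb => hu b (by simp [hb])]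

theorem containedUpTo_shift_of_dom
    (hcl : ∀ q a q' o, q < N → a < m → δ q a = some (q', o) → q' < N ∧ ∀ b ∈ o, b < m)
    (hne : ∀ q a q' o, δ q a = some (q', o) → o ≠ [])
    (hid : ∀ a < m, δ 0 a = some (0, [a])) {w : List ℕ} {q₀ : ℕ} (hw : ∀ b ∈ w, b < m)
    (hw' : w ≠ []) (hq : q₀ < N) (h : (StateTransition.eval (queueStep δ) (q₀, w)).Dom) :
    ∃ K, ContainedUpTo (shiftGamma ℕ K) (OSem (burstNT m))
      (OSem (guessNT N m δ [([], 0), (w, q₀)])) := by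
  obtain ⟨K, hK⟩ := (eval_dom_iff_exists_not_lasts _ _).1 h
  refine ⟨K, fun g hg => ?_⟩
  obtain ⟨p, hp, os, hacc, hos⟩ := mem_OSem_iff.1 hg
  obtain rfl : p = 0 := by simpa [burstNT] using hp
  obtain ⟨hu, hv, h1⟩ := burstNT_sound hacc
  have hlen := hacc.length_eq
  have hz1 : ∀ z, 1 ≤ z → z ≤ g.out.length → g.orig z = 1 := fun z hz hz' => by
    rw [hos z hz hz', List.getD_eq_getElem _ _ (by omega)]
    exact h1 _ (List.getElem_mem _)
  have hu₁ : ∀ a ∈ g.inp.take K, a < m := fun a ha => hu a (List.mem_of_mem_take ha)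
  have hu₂ : ∀ a ∈ g.inp.drop K, a < m := fun a ha => hu a (List.mem_of_mem_drop ha)
  obtain ⟨os', hacc', hle⟩ : ∃ os', NTAccepts (guessNT N m δ [([], 0), (w, q₀)]) 3 0
      (g.inp.take K ++ g.inp.drop K) g.out os' ∧ ∀ x ∈ os', x ≤ max (g.inp.take K).length 1 := by
    by_cases hpre : g.inp.take K <+: g.out
    · refine guessNT_start_complete hcl (w := w) (q := q₀) (by simp) hw hq hu₁ hu₂ hv ?_
      by_cases hl : g.inp.length ≤ K
      · exact Or.inl (List.drop_eq_nil_of_le hl)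
      · refine Or.inr fun o ho hpo => hK ?_
        have := lasts_of_seqOut hne hw' ho hpo hpre
        rwa [List.length_take, min_eq_left (by omega)] at this
    · refine guessNT_start_complete hcl (w := []) (q := 0) (by simp) (by simp) (by omega) hu₁ hu₂
        hv (Or.inr fun o ho => ?_)
      rw [seqOut_copy hid hu₁] at ho
      cases ho
      exact hpre
  rw [List.take_append_drop] at hacc'
  have hlen' := hacc'.length_eq
  have hget : ∀ z, 1 ≤ z → z ≤ g.out.length → os'.getD (z - 1) 1 ∈ os' := fun z hz hz' => by
    rw [List.getD_eq_getElem _ _ (by omega)]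
    exact List.getElem_mem _
  refine ⟨⟨g.inp, g.out, fun z => os'.getD (z - 1) 1, g.inp_ne, fun z hz hz' => ?_⟩, ?_, rfl, rfl,
    fun _ _ => true, fun z hz hz' => ?_⟩
  · have := hacc'.mem_orig _ (hget z hz hz')
    have := List.length_pos_iff.2 g.inp_ne
    omega
  · exact mem_OSem_iff.2 ⟨3, by simp [guessNT], os', hacc', fun _ _ _ => rfl⟩
  · have h₁ := hacc'.mem_orig _ (hget z hz hz')
    have h₂ := hle _ (hget z hz hz')
    rw [List.length_take] at h₂
    refine ⟨_, _, _, _, rfl, ?_, ?_⟩ <;> simp only [hz1 z hz hz'] <;> omega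

theorem dom_of_containedUpTo
    (hcl : ∀ q a q' o, q < N → a < m → δ q a = some (q', o) → q' < N ∧ ∀ b ∈ o, b < m)
    (hne : ∀ q a q' o, δ q a = some (q', o) → o ≠ [])
    (hid : ∀ a < m, δ 0 a = some (0, [a])) {w : List ℕ} {q₀ : ℕ} (hw : ∀ b ∈ w, b < m)
    (hq : q₀ < N) {l : ℕ} {γ : Set (List (RLetter ℕ l))} (hγ : BoundedResync γ)
    (h : ContainedUpTo γ (OSem (burstNT m)) (OSem (guessNT N m δ [([], 0), (w, q₀)]))) :
    (StateTransition.eval (queueStep δ) (q₀, w)).Dom := by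
  obtain ⟨k, hk⟩ := hγ
  rw [eval_dom_iff_exists_not_lasts]
  refine ⟨k + 1, fun hl => ?_⟩
  obtain ⟨u, o, y, hu, ho, he, hb⟩ := exists_seqOut_of_lasts hcl hq hw hl
  have hun : u ≠ [] := by rintro rfl; simp at hu
  have hum : ∀ a ∈ u, a < m := fun a ha => hb a (by simp [ha])
  obtain ⟨g, hg, hi, ho', I, hI⟩ := h ⟨u, u ++ y, fun _ => 1, hun, fun _ _ _ => by omega⟩
    (mem_OSem_iff.2 ⟨0, by simp [burstNT], _, burstNT_accepts hun hum hb, fun z hz hz' => by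
      simp only [List.length_append] at hz'
      rw [List.getD_eq_getElem _ _ (by simp; omega), List.getElem_map]⟩)
  obtain ⟨p, hp, os, hacc, hos⟩ := mem_OSem_iff.1 hg
  obtain rfl : p = 3 := by simpa [guessNT] using hp
  simp only at hi ho' hI
  have hlen := hacc.length_eq
  rw [hi, ho'] at hacc
  have hmem := guessNT_start_sound hne hun hacc (by
    simp only [List.mem_cons, List.not_mem_nil, or_false, forall_eq_or_imp, forall_eq]
    exact ⟨⟨u, seqOut_copy hid hum, by simp⟩, ⟨o, ho, by simp [he]⟩⟩)
  have hsub : Set.Icc 1 (k + 1) ⊆ {x : ℕ | 1 ≤ x ∧ x ≤ u.length ∧ RSat γ u I x 1} := by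
    rintro j ⟨h₁, h₂⟩
    refine ⟨h₁, by omega, ?_⟩
    obtain ⟨i, hi', rfl⟩ := List.getElem_of_mem (hmem j h₁ (by omega))
    have hz := hos (i + 1) (by omega) (by omega)
    rw [Nat.add_sub_cancel, List.getD_eq_getElem _ _ hi'] at hz
    have := hI (i + 1) (by omega) (by rw [← ho', ← hlen]; omega)
    rwa [hz, hi] at this
  have hfin : {x : ℕ | 1 ≤ x ∧ x ≤ u.length ∧ RSat γ u I x 1}.Finite :=
    (Set.finite_Icc 1 u.length).subset fun x hx => ⟨hx.1, hx.2.1⟩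
  have h₁ := Set.ncard_le_ncard hsub hfin
  have h₂ := hk u I 1 le_rfl (by omega)
  rw [Set.ncard_eq_toFinset_card', Set.toFinset_Icc, Nat.card_Icc] at h₁
  omega

end queue

section simulation

open Turing StateTransition

variable {K G Λ σ : Type}

/-- The queue alphabet for simulating a multi-stack machine: an end marker `none`, a blank
`some none`, and a symbol `some (some (k, g))` for the letter `g` on stack `k`. -/
abbrev StackLetter (K G : Type) : Type := Option (Option (K × G))

/-- The states of the queue machine simulating a multi-stack machine: `none` is the halting state,
`some (false, s, v)` waits for the end marker to execute `s` and `some (true, s, v)` is searching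
for the top of the stack accessed by the statement `s`. -/
abbrev StackState (K G Λ σ : Type) : Type := Option (Bool × TM2.Stmt (fun _ : K => G) Λ σ × σ)

/-- The states of the queue machine simulating a multi-stack machine supported by `S`. -/
def StackSupported (M : Λ → TM2.Stmt (fun _ : K => G) Λ σ) (S : Finset Λ)
    (p : StackState K G Λ σ) : Prop :=
  ∀ b s v, p = some (b, s, v) → some s ∈ TM2.stmts M S

theorem stackSupported_finite [Finite σ] (M : Λ → TM2.Stmt (fun _ : K => G) Λ σ) (S : Finset Λ) :
    {p | StackSupported M S p}.Finite := by
  have h : ((Set.univ : Set Bool) ×ˢ {s | some s ∈ TM2.stmts M S} ×ˢ (Set.univ : Set σ)).Finite :=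
    Set.finite_univ.prod (Set.Finite.prod ((TM2.stmts M S).finite_toSet.preimage
      (Option.some_injective _).injOn) Set.finite_univ)
  refine ((h.image some).insert none).subset ?_
  rintro (_ | ⟨b, s, v⟩) hp
  · simp
  · exact Or.inr ⟨(b, s, v), ⟨trivial, hp b s v rfl, trivial⟩, rfl⟩

variable [DecidableEq K]

/-- The letter on stack `k` represented by a letter of the queue. -/
def onStack (k : K) : StackLetter K G → Option G
  | some (some (j, g)) => if j = k then some g else none
  | _ => none

/-- The action of the simulating queue machine on the end marker. -/
def queueExec (M : Λ → TM2.Stmt (fun _ : K => G) Λ σ) :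
    TM2.Stmt (fun _ : K => G) Λ σ → σ → StackState K G Λ σ × List (StackLetter K G)
  | .push k f q, v => (some (false, q, v), [none, some (some (k, f v))])
  | .peek k f q, v => (some (true, .peek k f q, v), [none])
  | .pop k f q, v => (some (true, .pop k f q, v), [none])
  | .load f q, v => (some (false, q, f v), [none])
  | .branch f q₁ q₂, v => (some (false, cond (f v) q₁ q₂, v), [none])
  | .goto l, v => (some (false, M (l v), v), [none])
  | .halt, _ => (none, [none])

/-- The action of the simulating queue machine when searching for the top of a stack. -/
def queueSearch : TM2.Stmt (fun _ : K => G) Λ σ → σ → StackLetter K G →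
    StackState K G Λ σ × List (StackLetter K G)
  | .pop k f q, v, a => match a, onStack k a with
    | none, _ => (some (false, q, f v none), [none])
    | some _, some g => (some (false, q, f v (some g)), [some none])
    | some b, none => (some (true, .pop k f q, v), [some b])
  | .peek k f q, v, a => match a, onStack k a with
    | none, _ => (some (false, q, f v none), [none])
    | some b, some g => (some (false, q, f v (some g)), [some b])
    | some b, none => (some (true, .peek k f q, v), [some b])
  | s, v, a => (some (true, s, v), [a])

/-- The transition function of the queue machine simulating the multi-stack machine `M`. -/
def stackQueue (M : Λ → TM2.Stmt (fun _ : K => G) Λ σ) :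
    StackState K G Λ σ → StackLetter K G → Option (StackState K G Λ σ × List (StackLetter K G))
  | some (false, s, v), none => some (queueExec M s v)
  | some (true, s, v), a => some (queueSearch s v a)
  | none, none => none
  | p, a => some (p, [a])

theorem stackQueue_out_ne (M : Λ → TM2.Stmt (fun _ : K => G) Λ σ) {p p' : StackState K G Λ σ}
    {a : StackLetter K G} {o : List (StackLetter K G)} (h : stackQueue M p a = some (p', o)) :
    o ≠ [] := by
  rintro rfl
  unfold stackQueue at h
  split at h
  · rename_i s v
    cases s <;> simp [queueExec] at h
  · rename_i s v a
    simp only [Option.some.injEq] at h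
    unfold queueSearch at h
    repeat' split at h
    all_goals simp at h
  · simp at h
  · simp at h

/-- The queue contents representing the stacks `S`. -/
def StackRep (S : K → List G) (x : List (StackLetter K G)) : Prop :=
  none ∉ x ∧ ∀ k, x.filterMap (onStack k) = S k

/-- The relation between configurations of a multi-stack machine and those of the simulating
queue machine. -/
def StackRel (M : Λ → TM2.Stmt (fun _ : K => G) Λ σ) (c : TM2.Cfg (fun _ : K => G) Λ σ)
    (d : StackState K G Λ σ × List (StackLetter K G)) : Prop :=
  d.1 = c.l.map (fun l => (false, M l, c.var)) ∧ ∃ x, d.2 = none :: x ∧ StackRep c.stk x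

variable {M : Λ → TM2.Stmt (fun _ : K => G) Λ σ}

theorem reaches_cons {τ : Type} {f : τ → Option τ} {a b c : τ} (h : f a = some b)
    (hr : Reaches f b c) : Reaches f a c :=
  .head h hr

theorem reaches_rotate {p : StackState K G Λ σ} (hp : p = none ∨ ∃ s v, p = some (false, s, v))
    {x : List (StackLetter K G)} : none ∉ x → ∀ y,
    Reaches (queueStep (stackQueue M)) (p, x ++ y) (p, y ++ x) := by
  induction x with
  | nil => intro _ y; rw [List.nil_append, List.append_nil]; exact .refl
  | cons a x ih =>
    intro hx y
    obtain ⟨b, rfl⟩ : ∃ b, a = some b := Option.ne_none_iff_exists'.1 fun h => hx (by simp [h])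
    refine reaches_cons (b := (p, x ++ (y ++ [some b]))) ?_ ?_
    · obtain rfl | ⟨s, v, rfl⟩ := hp <;> simp [queueStep, stackQueue]
    · simpa using ih (fun h => hx (by simp [h])) (y ++ [some b])

theorem reaches_pop (k : K) (f : σ → Option G → σ) (q : TM2.Stmt (fun _ : K => G) Λ σ) (v : σ)
    {x : List (StackLetter K G)} : none ∉ x → ∀ y, none ∉ y → ∃ x', none ∉ x' ∧
      x'.filterMap (onStack k) = (x.filterMap (onStack k)).tail ∧
      (∀ j ≠ k, x'.filterMap (onStack j) = x.filterMap (onStack j)) ∧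
      Reaches (queueStep (stackQueue M)) (some (true, .pop k f q, v), x ++ none :: y)
        (some (false, q, f v (x.filterMap (onStack k)).head?), none :: (y ++ x')) := by
  induction x with
  | nil =>
    intro _ y hy
    refine ⟨[], by simp, by simp, by simp, reaches_cons (b := (some (false, q, f v none), y ++ [none]))
      ?_ ?_⟩
    · simp [queueStep, stackQueue, queueSearch]
    · simpa using reaches_rotate (M := M) (Or.inr ⟨_, _, rfl⟩) hy [none]
  | cons a x ih =>
    intro hx y hy
    obtain ⟨b, rfl⟩ : ∃ b, a = some b := Option.ne_none_iff_exists'.1 fun h => hx (by simp [h])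
    have hx' : none ∉ x := fun h => hx (by simp [h])
    rcases hb : onStack k (some b) with _ | g
    · obtain ⟨x', h₁, h₂, h₃, h₄⟩ := ih hx' (y ++ [some b]) (by simpa using hy)
      refine ⟨some b :: x', by simpa using h₁, ?_, fun j hj => ?_, reaches_cons
        (b := (some (true, .pop k f q, v), x ++ none :: (y ++ [some b]))) ?_ ?_⟩
      · simpa [List.filterMap_cons, hb] using h₂
      · rw [List.filterMap_cons, List.filterMap_cons, h₃ j hj]
      · simp [queueStep, stackQueue, queueSearch, hb]
      · simpa [List.filterMap_cons, hb] using h₄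
    · refine ⟨some none :: x, by simpa using hx', ?_, fun j hj => ?_, reaches_cons
        (b := (some (false, q, f v (some g)), x ++ none :: (y ++ [some none]))) ?_ ?_⟩
      · rw [List.filterMap_cons_some hb, List.filterMap_cons_none rfl, List.tail_cons]
      · rcases b with _ | ⟨i, g'⟩
        · rfl
        · have : i = k := by
            by_contra hne
            simp [onStack, hne] at hb
          have hne : ¬ k = j := fun h => hj h.symm
          simp [List.filterMap_cons, onStack, this, hne]
      · simp [queueStep, stackQueue, queueSearch, hb]
      · have h := reaches_rotate (M := M) (Or.inr ⟨q, f v (some g), rfl⟩) hx'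
          (none :: (y ++ [some none]))
        rw [List.cons_append, List.append_assoc] at h
        rw [List.filterMap_cons_some hb]
        exact h

theorem reaches_peek (k : K) (f : σ → Option G → σ) (q : TM2.Stmt (fun _ : K => G) Λ σ) (v : σ)
    {x : List (StackLetter K G)} : none ∉ x → ∀ y, none ∉ y →
      Reaches (queueStep (stackQueue M)) (some (true, .peek k f q, v), x ++ none :: y)
        (some (false, q, f v (x.filterMap (onStack k)).head?), none :: (y ++ x)) := by
  induction x with
  | nil =>
    intro _ y hy
    refine reaches_cons (b := (some (false, q, f v none), y ++ [none])) ?_ ?_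
    · simp [queueStep, stackQueue, queueSearch]
    · simpa using reaches_rotate (M := M) (Or.inr ⟨_, _, rfl⟩) hy [none]
  | cons a x ih =>
    intro hx y hy
    obtain ⟨b, rfl⟩ : ∃ b, a = some b := Option.ne_none_iff_exists'.1 fun h => hx (by simp [h])
    have hx' : none ∉ x := fun h => hx (by simp [h])
    rcases hb : onStack k (some b) with _ | g
    · refine reaches_cons (b := (some (true, .peek k f q, v), x ++ none :: (y ++ [some b]))) ?_ ?_
      · simp [queueStep, stackQueue, queueSearch, hb]
      · simpa [List.filterMap_cons, hb] using ih hx' (y ++ [some b]) (by simpa using hy)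
    · refine reaches_cons (b := (some (false, q, f v (some g)), x ++ none :: (y ++ [some b]))) ?_ ?_
      · simp [queueStep, stackQueue, queueSearch, hb]
      · simpa [List.filterMap_cons, hb] using
          reaches_rotate (M := M) (Or.inr ⟨q, f v (some g), rfl⟩) hx' (none :: (y ++ [some b]))

theorem stackRel_stepAux (s : TM2.Stmt (fun _ : K => G) Λ σ) :
    ∀ (v : σ) (S : K → List G) (x : List (StackLetter K G)), StackRep S x →
      ∃ d, StackRel M (TM2.stepAux s v S) d ∧
        Reaches₁ (queueStep (stackQueue M)) (some (false, s, v), none :: x) d := by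
  have rot : ∀ {q v x y}, none ∉ x → Reaches (queueStep (stackQueue M))
      (some (false, q, v), x ++ y) (some (false, q, v), y ++ x) :=
    fun {q v x y} hx => reaches_rotate (Or.inr ⟨q, v, rfl⟩) hx y
  induction s with
  | push k f q ih =>
    intro v S x hx
    obtain ⟨d, hd, hr⟩ := ih v (Function.update S k (f v :: S k)) (some (some (k, f v)) :: x)
      ⟨by simpa using hx.1, fun j => by
        by_cases hj : j = k
        · subst hj
          simp [onStack, hx.2]
        · have hne : ¬ k = j := fun h => hj h.symm
          simp [onStack, hx.2, hj, hne]⟩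
    refine ⟨d, hd, .head (b := (some (false, q, v), x ++ [none, some (some (k, f v))])) ?_
      (Relation.TransGen.trans_right (rot hx.1) hr)⟩
    simp [queueStep, stackQueue, queueExec]
  | peek k f q ih =>
    intro v S x hx
    obtain ⟨d, hd, hr⟩ := ih (f v (S k).head?) S x hx
    refine ⟨d, hd, .head (b := (some (true, .peek k f q, v), x ++ [none])) ?_
      (Relation.TransGen.trans_right (?_ : Reaches _ _ _) hr)⟩
    · simp [queueStep, stackQueue, queueExec]
    · simpa [hx.2] using reaches_peek (M := M) k f q v hx.1 [] (by simp)
  | pop k f q ih =>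
    intro v S x hx
    obtain ⟨x', h₁, h₂, h₃, h₄⟩ := reaches_pop (M := M) k f q v hx.1 [] (by simp)
    obtain ⟨d, hd, hr⟩ := ih (f v (S k).head?) (Function.update S k (S k).tail) x'
      ⟨h₁, fun j => by
        by_cases hj : j = k
        · subst hj
          simp [h₂, hx.2]
        · simp [h₃ j hj, hx.2, hj]⟩
    refine ⟨d, hd, .head (b := (some (true, .pop k f q, v), x ++ [none])) ?_
      (Relation.TransGen.trans_right (?_ : Reaches _ _ _) hr)⟩
    · simp [queueStep, stackQueue, queueExec]
    · simpa [hx.2] using h₄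
  | load f q ih =>
    intro v S x hx
    obtain ⟨d, hd, hr⟩ := ih (f v) S x hx
    refine ⟨d, hd, .head (b := (some (false, q, f v), x ++ [none])) ?_
      (Relation.TransGen.trans_right (rot hx.1) hr)⟩
    simp [queueStep, stackQueue, queueExec]
  | branch f q₁ q₂ ih₁ ih₂ =>
    intro v S x hx
    obtain ⟨d, hd, hr⟩ : ∃ d, StackRel M (TM2.stepAux (.branch f q₁ q₂) v S) d ∧
        Reaches₁ (queueStep (stackQueue M)) (some (false, cond (f v) q₁ q₂, v), none :: x) d := by
      rw [TM2.stepAux]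
      cases f v
      · exact ih₂ v S x hx
      · exact ih₁ v S x hx
    refine ⟨d, hd, .head (b := (some (false, cond (f v) q₁ q₂, v), x ++ [none])) ?_
      (Relation.TransGen.trans_right (rot hx.1) hr)⟩
    simp [queueStep, stackQueue, queueExec]
  | goto l =>
    intro v S x hx
    refine ⟨(some (false, M (l v), v), none :: x), ⟨rfl, x, rfl, hx⟩,
      .head' (b := (some (false, M (l v), v), x ++ [none])) ?_ (rot hx.1)⟩
    simp [queueStep, stackQueue, queueExec]
  | halt =>
    intro v S x hx
    refine ⟨(none, none :: x), ⟨rfl, x, rfl, hx⟩,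
      .head' (b := (none, x ++ [none])) ?_ (reaches_rotate (Or.inl rfl) hx.1 [none])⟩
    simp [queueStep, stackQueue, queueExec]

theorem stackQueue_respects :
    Respects (TM2.step M) (queueStep (stackQueue M)) (StackRel M) := by
  rintro ⟨_ | l, v, S⟩ ⟨_, _⟩ ⟨h, x, rfl, hx⟩
  · subst h
    rfl
  · subst h
    exact stackRel_stepAux (M l) v S x hx

theorem stackQueue_supported [Inhabited Λ] {S : Finset Λ} (hS : TM2.Supports M S)
    {p p' : StackState K G Λ σ} {a : StackLetter K G} {o : List (StackLetter K G)}
    (hp : StackSupported M S p) (h : stackQueue M p a = some (p', o)) :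
    StackSupported M S p' := by
  have sub : ∀ {q s : TM2.Stmt (fun _ : K => G) Λ σ}, some s ∈ TM2.stmts M S →
      q ∈ TM2.stmts₁ s → some q ∈ TM2.stmts M S := fun hs hq => TM2.stmts_trans hq hs
  have self := @TM2.stmts₁_self K (fun _ => G) Λ σ
  unfold stackQueue at h
  split at h
  · rename_i s v
    have hs := hp _ _ _ rfl
    cases s <;> simp only [queueExec, Option.some.injEq, Prod.mk.injEq] at h <;>
      obtain ⟨rfl, -⟩ := h <;> rintro _ _ _ ⟨⟩
    case push => exact sub hs (by simp [TM2.stmts₁, self])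
    case peek => exact hs
    case pop => exact hs
    case load => exact sub hs (by simp [TM2.stmts₁, self])
    case branch f q₁ q₂ => exact sub hs (by cases f v <;> simp [TM2.stmts₁, self])
    case goto l =>
      have := TM2.stmts_supportsStmt hS hs v
      simp only [TM2.stmts, Finset.mem_insertNone, Finset.mem_biUnion]
      rintro _ ⟨⟩
      exact ⟨_, this, self⟩
  · rename_i s v a
    have hs := hp _ _ _ rfl
    simp only [Option.some.injEq] at h
    unfold queueSearch at h
    repeat' split at h
    all_goals
      cases h
      rintro _ _ _ ⟨⟩
      first
      | exact hs
      | exact sub hs (by simp [TM2.stmts₁, self])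
  · simp at h
  · cases h
    exact hp

end simulation

theorem exists_nat_queue {Q A : Type} [Finite A] {δ : Q → A → Option (Q × List A)} {P : Set Q}
    (hP : P.Finite) (hcl : ∀ q a q' o, q ∈ P → δ q a = some (q', o) → q' ∈ P)
    (hne : ∀ q a q' o, δ q a = some (q', o) → o ≠ []) {q₀ : Q} (hq₀ : q₀ ∈ P) :
    ∃ (N m : ℕ) (δ' : ℕ → ℕ → Option (ℕ × List ℕ)) (e : A → ℕ) (p₀ : ℕ),
      (∀ q a q' o, q < N → a < m → δ' q a = some (q', o) → q' < N ∧ ∀ b ∈ o, b < m) ∧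
      (∀ q a q' o, δ' q a = some (q', o) → o ≠ []) ∧
      (∀ a < m, δ' 0 a = some (0, [a])) ∧ p₀ < N ∧ (∀ a, e a < m) ∧
      ∀ x : List A, (StateTransition.eval (queueStep δ') (p₀, x.map e)).Dom ↔
        (StateTransition.eval (queueStep δ) (q₀, x)).Dom := by
  classical
  have : Finite P := hP
  obtain ⟨m, ⟨eA⟩⟩ := Finite.exists_equiv_fin A
  obtain ⟨n, ⟨eP⟩⟩ := Finite.exists_equiv_fin P
  let e : A → ℕ := fun a => eA a
  let eQ : Q → ℕ := fun q => if h : q ∈ P then eP ⟨q, h⟩ + 1 else 0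
  have heQ : ∀ q, eQ q < n + 1 := fun q => by
    by_cases h : q ∈ P
    · simp [eQ, h]
    · simp [eQ, h]
  let δ' : ℕ → ℕ → Option (ℕ × List ℕ) := fun p a =>
    if p = 0 then some (0, [a]) else
      if h : p - 1 < n ∧ a < m then
        (δ (eP.symm ⟨p - 1, h.1⟩) (eA.symm ⟨a, h.2⟩)).map fun r => (eQ r.1, r.2.map e)
      else none
  have hδ' : ∀ q ∈ P, ∀ a, δ' (eQ q) (e a) = (δ q a).map fun r => (eQ r.1, r.2.map e) := by
    intro q hq a
    simp [δ', eQ, e, hq]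
  have hstep : ∀ p a q' o, δ' p a = some (q', o) → (q' = 0 ∧ o = [a]) ∨
      ∃ q b r, δ q b = some r ∧ q' = eQ r.1 ∧ o = r.2.map e := by
    intro p a q' o h
    simp only [δ'] at h
    split at h
    · simp only [Option.some.injEq, Prod.mk.injEq] at h
      exact Or.inl ⟨h.1.symm, h.2.symm⟩
    · split at h
      · simp only [Option.map_eq_some_iff, Prod.mk.injEq] at h
        obtain ⟨r, hr, h₁, h₂⟩ := h
        exact Or.inr ⟨_, _, r, hr, h₁.symm, h₂.symm⟩
      · simp at h
  refine ⟨n + 1, m, δ', e, eQ q₀, fun q a q' o _ ha h => ?_, fun q a q' o h => ?_, fun a _ => ?_,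
    heQ _, fun a => (eA a).2, fun x => ?_⟩
  · obtain ⟨rfl, rfl⟩ | ⟨_, _, r, _, rfl, rfl⟩ := hstep _ _ _ _ h
    · simpa using ha
    · exact ⟨heQ _, by simp [e]⟩
  · obtain ⟨rfl, rfl⟩ | ⟨_, _, r, hr, rfl, rfl⟩ := hstep _ _ _ _ h
    · simp
    · simpa using hne _ _ _ _ hr
  · simp [δ']
  · refine StateTransition.tr_eval_dom (tr := fun c d => c.1 ∈ P ∧ d = (eQ c.1, c.2.map e))
      ?_ ⟨hq₀, rfl⟩
    rintro ⟨q, _ | ⟨a, y⟩⟩ _ ⟨hq, rfl⟩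
    · simp [queueStep]
    · rcases h : δ q a with _ | ⟨q', o⟩
      · simp [queueStep, h, hδ' q hq]
      · simp only [queueStep, h, Option.map_some]
        refine ⟨_, ⟨hcl _ _ _ _ hq h, rfl⟩, .single ?_⟩
        simp [queueStep, h, hδ' q hq]

section undecidability

open Turing

/-- Binary increment, least significant digit first. -/
def bitSucc (l : List Bool) : List Bool :=
  List.recOn l [true] fun b l ih => cond b (false :: ih) (true :: l)

theorem primrec_bitSucc : Primrec bitSucc :=
  Primrec.list_rec (h := fun (_ : List Bool) r => cond r.1 (false :: r.2.2) (true :: r.2.1))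
    Primrec.id (Primrec.const [true])
    (Primrec.cond (Primrec.fst.comp Primrec.snd)
      (Primrec.list_cons.comp (Primrec.const false) (Primrec.snd.comp (Primrec.snd.comp Primrec.snd)))
      (Primrec.list_cons.comp (Primrec.const true)
        (Primrec.fst.comp (Primrec.snd.comp Primrec.snd)))).to₂

theorem trPosNum_succ {l : List Bool} (n : PosNum)
    (h : PartrecToTM2.trPosNum n = l.map fun b => cond b .bit1 .bit0) :
    PartrecToTM2.trPosNum n.succ = (bitSucc l).map fun b => cond b .bit1 .bit0 := by
  induction n generalizing l with
  | one =>
    rcases l with _ | ⟨_ | _, _ | ⟨_, _⟩⟩ <;> simp_all [PartrecToTM2.trPosNum, bitSucc, PosNum.succ]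
  | bit1 n ih =>
    rcases l with _ | ⟨b, l⟩
    · simp [PartrecToTM2.trPosNum] at h
    · simp only [PartrecToTM2.trPosNum, List.map_cons, List.cons.injEq] at h
      cases b
      · simp at h
      · simp [PosNum.succ, PartrecToTM2.trPosNum, ih h.2, bitSucc]
  | bit0 n ih =>
    rcases l with _ | ⟨b, l⟩
    · simp [PartrecToTM2.trPosNum] at h
    · simp only [PartrecToTM2.trPosNum, List.map_cons, List.cons.injEq] at h
      cases b
      · simp [PosNum.succ, PartrecToTM2.trPosNum, h.2, bitSucc]
      · simp at h

theorem trNat_eq_map (n : ℕ) :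
    PartrecToTM2.trNat n =
      (Nat.rec [] (fun _ l => bitSucc l) n : List Bool).map fun b => cond b .bit1 .bit0 := by
  induction n with
  | zero => simp
  | succ n ih =>
    change _ = (bitSucc (Nat.rec [] (fun _ l => bitSucc l) n)).map _
    rw [PartrecToTM2.trNat, Nat.cast_succ, Num.add_one]
    rw [PartrecToTM2.trNat] at ih
    generalize (Nat.rec [] (fun _ l => bitSucc l) n : List Bool) = l at *
    generalize (n : Num) = k at *
    rcases k with _ | p
    · cases List.map_eq_nil_iff.1 ih.symm
      rfl
    · exact trPosNum_succ p ih

theorem primrec_map_trNat (e : PartrecToTM2.Γ' → ℕ) :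
    Primrec fun n => (PartrecToTM2.trNat n).map e := by
  have h : Primrec (Nat.rec [] fun _ l => bitSucc l : ℕ → List Bool) :=
    Primrec.nat_rec₁ [] (primrec_bitSucc.comp₂ Primrec₂.right)
  refine (Primrec.list_map (g := fun (_ : ℕ) b => e (cond b .bit1 .bit0)) h
    ((Primrec.dom_finite fun b => e (cond b .bit1 .bit0)).comp₂ Primrec₂.right)).of_eq fun n => ?_
  rw [trNat_eq_map, List.map_map]
  rfl

theorem primrec_emit (p : ℕ) (x : Option ℕ) (q : ℕ) : Primrec fun o => emit p x o q := by
  have h : Primrec fun r : List ℕ × ℕ => (p, x, r.1.take r.2, 4 + 2 * r.1.getD r.2 0) :=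
    .pair (.const p) (.pair (.const x) (.pair (Primrec.list_take.comp Primrec.snd Primrec.fst)
      (Primrec.nat_add.comp (.const 4) (Primrec.nat_mul.comp (.const 2)
        ((Primrec.list_getD 0).comp Primrec.fst Primrec.snd)))))
  exact Primrec.list_cons.comp
    (.pair (.const p) (.pair (.const x) (.pair .id (.const q))))
    (Primrec.list_map (g := fun o i => (p, x, o.take i, 4 + 2 * o.getD i 0))
      (Primrec.list_range.comp Primrec.list_length) h.to₂)

theorem primrec_guessNT (N m : ℕ) (δ : ℕ → ℕ → Option (ℕ × List ℕ)) (q : ℕ) :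
    Primrec fun w => guessNT N m δ [([], 0), (w, q)] := by
  refine .pair ?_ (.const _)
  refine Primrec.list_append.comp ?_ (.const _)
  simp only [List.flatMap_cons, List.flatMap_nil, List.append_nil]
  exact Primrec.list_append.comp (.const _) (primrec_emit 3 none _)

theorem exists_queue_machine (f : ℕ →. ℕ) (hf : Nat.Partrec f) :
    ∃ (N m : ℕ) (δ : ℕ → ℕ → Option (ℕ × List ℕ)) (q₀ : ℕ) (w : ℕ → List ℕ),
      (∀ q a q' o, q < N → a < m → δ q a = some (q', o) → q' < N ∧ ∀ b ∈ o, b < m) ∧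
      (∀ q a q' o, δ q a = some (q', o) → o ≠ []) ∧
      (∀ a < m, δ 0 a = some (0, [a])) ∧ q₀ < N ∧ (∀ n, ∀ b ∈ w n, b < m) ∧ (∀ n, w n ≠ []) ∧
      Primrec w ∧ ∀ n, (StateTransition.eval (queueStep δ) (q₀, w n)).Dom ↔ (f n).Dom := by
  obtain ⟨c, hc⟩ := ToPartrec.Code.exists_code (Nat.Partrec'.part_iff₁.2 (Partrec.nat_iff.2 hf))
  let M : PartrecToTM2.Λ' → TM2.Stmt (fun _ : PartrecToTM2.K' => PartrecToTM2.Γ') PartrecToTM2.Λ'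
    (Option PartrecToTM2.Γ') := PartrecToTM2.tr
  let l := PartrecToTM2.trNormal c .halt
  let S := PartrecToTM2.codeSupp c .halt
  let p₀ : StackState PartrecToTM2.K' PartrecToTM2.Γ' PartrecToTM2.Λ' (Option PartrecToTM2.Γ') :=
    some (false, M l, none)
  let : Inhabited PartrecToTM2.Λ' := ⟨l⟩
  have hS : TM2.Supports M S := PartrecToTM2.tr_supports c .halt
  have : Finite PartrecToTM2.K' := by
    refine Finite.of_surjective (fun i : Fin 4 => match i with
      | 0 => .main | 1 => .rev | 2 => .aux | 3 => PartrecToTM2.K'.stack) fun k => ?_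
    cases k
    exacts [⟨0, rfl⟩, ⟨1, rfl⟩, ⟨2, rfl⟩, ⟨3, rfl⟩]
  obtain ⟨N, m, δ, e, q₀, h₁, h₂, h₃, h₄, h₅, h₆⟩ := exists_nat_queue
    (δ := stackQueue M) (stackSupported_finite M S) (fun q a q' o => stackQueue_supported hS)
    (fun q a q' o => stackQueue_out_ne M) (q₀ := p₀) (by
      intro b s v h
      obtain ⟨-, rfl, -⟩ : false = b ∧ M l = s ∧ none = v := by
        simpa only [p₀, Option.some.injEq, Prod.mk.injEq] using h
      simp only [TM2.stmts, Finset.mem_insertNone, Finset.mem_biUnion]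
      rintro _ ⟨⟩
      exact ⟨l, hS.1, TM2.stmts₁_self⟩)
  let W : ℕ → List (StackLetter PartrecToTM2.K' PartrecToTM2.Γ') := fun n =>
    none :: (PartrecToTM2.trList [n]).map fun g => some (some (.main, g))
  refine ⟨N, m, δ, q₀, fun n => (W n).map e, h₁, h₂, h₃, h₄, fun n b hb => ?_, fun n => by simp [W],
    ?_, fun n => ?_⟩
  · obtain ⟨a, -, rfl⟩ := List.mem_map.1 hb
    exact h₅ a
  · have := primrec_map_trNat fun g => e (some (some (.main, g)))
    refine (Primrec.list_cons.comp (.const (e none))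
      (Primrec.list_append.comp this (.const [e (some (some (.main, .cons)))]))).of_eq fun n => ?_
    simp [W, PartrecToTM2.trList, Function.comp_def]
  · rw [h₆]
    have hrel : StackRel M (PartrecToTM2.init c [n]) (p₀, W n) := by
      refine ⟨rfl, _, rfl, by simp, fun k => ?_⟩
      cases k <;> simp [List.filterMap_map, Function.comp_def, onStack, PartrecToTM2.init]
    refine (StateTransition.tr_eval_dom stackQueue_respects hrel).trans ?_
    have he := PartrecToTM2.tr_eval c [n]
    have hcn := hc (n ::ᵥ .nil)
    exact iff_of_eq (congrArg Part.Dom (he.trans (congrArg (PartrecToTM2.halt <$> ·) hcn)))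

end undecidability

/-- For any class `C` of bounded regular resynchronizers containing all `k`-shift
resynchronizers, it is undecidable, given two 1NTs `T₁, T₂`, whether there exists
`R ∈ C` with `⟦T₁⟧ᵒ ⊆ R(⟦T₂⟧ᵒ)`. -/
theorem resyncLE_restricted_class_undecidable
    (C : Set ((m : ℕ) × Set (List (RLetter ℕ m))))
    (hC : ∀ R ∈ C, IsRegularLang R.2 ∧ BoundedResync R.2)
    (hshift : ∀ k : ℕ, (⟨0, shiftGamma ℕ k⟩ : (m : ℕ) × Set (List (RLetter ℕ m))) ∈ C) :
    ¬ ComputablePred fun p : NT1 × NT1 =>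
        ∃ R ∈ C, ContainedUpTo R.2 (OSem p.1) (OSem p.2) := by
  intro h
  obtain ⟨N, m, δ, q₀, w, hcl, hne, hid, hq, hw, hw', hwp, hdom⟩ := exists_queue_machine
    (fun k => (Denumerable.ofNat Nat.Partrec.Code k).eval 0)
    (Partrec.nat_iff.1 (Nat.Partrec.Code.eval_part.comp (Computable.ofNat _) (Computable.const 0)))
  refine ComputablePred.halting_problem 0 (ComputablePred.computable_of_manyOneReducible
    (q := fun p : NT1 × NT1 => ∃ R ∈ C, ContainedUpTo R.2 (OSem p.1) (OSem p.2))
    ⟨fun c => (burstNT m, guessNT N m δ [([], 0), (w (Encodable.encode c), q₀)]),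
      (Primrec.pair (.const _)
        ((primrec_guessNT N m δ q₀).comp (hwp.comp Primrec.encode))).to_comp, fun c => ?_⟩ h)
  have hc := hdom (Encodable.encode c)
  rw [Denumerable.ofNat_encode] at hc
  refine hc.symm.trans ?_
  constructor
  · intro hd
    obtain ⟨K, hK⟩ := containedUpTo_shift_of_dom hcl hne hid (hw _) (hw' _) hq hd
    exact ⟨_, hshift K, hK⟩
  · rintro ⟨R, hR, hRc⟩
    exact dom_of_containedUpTo hcl hne hid (hw _) hq (hC R hR).2 hRc
end

section
/- If an extended regular resynchronizer R = (α, β, γ, δ) with m input parameters and n output parameters is bounded by k, then the simplified regular resynchronizer R' with m input parameters whose language is γ' = ⋃_{τ ∈ Γ × {0,1}ⁿ} γ(τ) satisfies: γ' is a regular language over Σ × {0,1}^(m+2), R' is bounded by k·|Γ|·2ⁿ, and ⟦R⟧ ⊆ ⟦R'⟧. Consequently, if containment of a set S₁ of origin graphs in a resynchronization of a set S₂ is witnessed by a bounded extended regular resynchronizer, it is also witnessed by a bounded simplified regular resynchronizer. -/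
/-- The word over `Σ × {0,1}^m` annotating `u` with the parameter valuation `Ī`
(positions are 1-indexed). -/
def annotP {Sig : Type} {m : ℕ} (u : List Sig) (I : Fin m → ℕ → Bool) :
    List (Sig × (Fin m → Bool)) :=
  u.mapIdx fun j a => (a, fun i => I i (j + 1))

/-- An output type: an output letter together with `n` output-parameter bits. -/
abbrev OutType (Gam : Type) (n : ℕ) : Type := Gam × (Fin n → Bool)

/-- The output type of the (1-indexed) position `z` of the output word `v` under the
output parameters `O` (`none` if `z` is not a position of `v`). -/
def outTypeAt {Gam : Type} {n : ℕ} (v : List Gam) (O : Fin n → ℕ → Bool) (z : ℕ) :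
    Option (OutType Gam n) :=
  (v[z - 1]?).map fun a => (a, fun i => O i z)

/-- An extended regular resynchronizer `(α, β, γ, δ)` with `m` input parameters and
`n` output parameters (the regularity of the component languages is stated separately). -/
structure ExtResync (Sig Gam : Type) (m n : ℕ) where
  alpha : Set (List (Sig × (Fin m → Bool)))
  beta : Set (List (Gam × (Fin n → Bool)))
  gamma : OutType Gam n → Set (List (RLetter Sig m))
  delta : OutType Gam n → OutType Gam n → Set (List (RLetter Sig m))

/-- `(g, g') ∈ ⟦R⟧` for an extended regular resynchronizer `R`. -/
def ExtRel {Sig Gam : Type} {m n : ℕ} (R : ExtResync Sig Gam m n)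
    (g g' : OriginGraph Sig Gam) : Prop :=
  g.inp = g'.inp ∧ g.out = g'.out ∧
    ∃ (I : Fin m → ℕ → Bool) (O : Fin n → ℕ → Bool),
      annotP g.inp I ∈ R.alpha ∧ annotP g.out O ∈ R.beta ∧
      (∀ z τ, 1 ≤ z → z ≤ g.out.length → outTypeAt g.out O z = some τ →
        RSat (R.gamma τ) g.inp I (g.orig z) (g'.orig z)) ∧
      (∀ z τ₁ τ₂, 1 ≤ z → z + 1 ≤ g.out.length →
        outTypeAt g.out O z = some τ₁ → outTypeAt g.out O (z + 1) = some τ₂ →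
        RSat (R.delta τ₁ τ₂) g.inp I (g'.orig z) (g'.orig (z + 1)))

/-- An extended regular resynchronizer is bounded by `k` if for every input word `u`,
input parameters `Ī`, output type `τ` and position `y` of `u`, there are at most `k`
distinct positions `x` of `u` with `(u, Ī, x, y) ⊨ γ(τ)`. -/
def ExtBoundedBy {Sig Gam : Type} {m n : ℕ} (R : ExtResync Sig Gam m n) (k : ℕ) : Prop :=
  ∀ (u : List Sig) (I : Fin m → ℕ → Bool) (τ : OutType Gam n) (y : ℕ),
    1 ≤ y → y ≤ u.length →
      {x : ℕ | 1 ≤ x ∧ x ≤ u.length ∧ RSat (R.gamma τ) u I x y}.ncard ≤ k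

/-- A finite union of regular languages is regular. -/
theorem IsRegularLang.iUnion {α ι : Type} [Fintype ι] {L : ι → Set (List α)}
    (h : ∀ i, IsRegularLang (L i)) : IsRegularLang (⋃ i, L i) := by
  classical
  choose Q hQ M hM using h
  refine ⟨∀ i, Q i, inferInstance,
    ⟨fun q a i => (M i).step (q i) a, fun i => (M i).start,
      {q | ∃ i, q i ∈ (M i).accept}⟩, ?_⟩
  have hfold : ∀ (w : List α) (q : ∀ i, Q i) (i : ι),
      w.foldl (fun (q : ∀ i, Q i) a i => (M i).step (q i) a) q i =
        w.foldl (M i).step (q i) := by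
    intro w
    induction w with
    | nil => simp
    | cons a w ih => intro q i; simp [ih]
  obtain rfl : L = fun i => (M i).accepts := funext fun i => (hM i).symm
  refine Set.ext fun w => Iff.trans ?_ Set.mem_iUnion.symm
  change (∃ i, w.foldl (fun (q : ∀ i, Q i) a i => (M i).step (q i) a) _ i ∈ (M i).accept) ↔
    ∃ i, w.foldl (M i).step (M i).start ∈ (M i).accept
  simp only [hfold]

theorem ExtBoundedBy.boundedBy_iUnion {Sig Gam : Type} [Fintype Gam] {m n k : ℕ}
    {R : ExtResync Sig Gam m n} (hk : ExtBoundedBy R k) :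
    BoundedBy (⋃ τ, R.gamma τ) (k * Fintype.card Gam * 2 ^ n) := by
  intro u I y hy hyu
  have hset : {x : ℕ | 1 ≤ x ∧ x ≤ u.length ∧ RSat (⋃ τ, R.gamma τ) u I x y} =
      ⋃ τ ∈ (Finset.univ : Finset (OutType Gam n)),
        {x : ℕ | 1 ≤ x ∧ x ≤ u.length ∧ RSat (R.gamma τ) u I x y} := by
    ext x
    simp [RSat]
  rw [hset]
  calc _ ≤ ∑ τ : OutType Gam n, {x : ℕ | 1 ≤ x ∧ x ≤ u.length ∧ RSat (R.gamma τ) u I x y}.ncard :=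
        Finset.set_ncard_biUnion_le _ _
    _ ≤ ∑ _τ : OutType Gam n, k := Finset.sum_le_sum fun τ _ => hk u I τ y hy hyu
    _ = k * Fintype.card Gam * 2 ^ n := by
        simp only [Finset.sum_const, Finset.card_univ, Fintype.card_prod, Fintype.card_fun,
          Fintype.card_bool, Fintype.card_fin, smul_eq_mul]
        ring

theorem ExtRel.resyncRel_iUnion {Sig Gam : Type} {m n : ℕ} {R : ExtResync Sig Gam m n}
    {g g' : OriginGraph Sig Gam} (h : ExtRel R g g') :
    ResyncRel (⋃ τ, R.gamma τ) g g' := by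
  obtain ⟨hinp, hout, I, O, -, -, hγ, -⟩ := h
  refine ⟨hinp, hout, I, fun z hz hz' => ?_⟩
  rw [← hout] at hz'
  have hlt : z - 1 < g.out.length := by omega
  exact Set.mem_iUnion.2 ⟨(g.out[z - 1], fun i => O i z),
    hγ z _ hz hz' (by simp [outTypeAt, List.getElem?_eq_getElem hlt])⟩

/-- If an extended regular resynchronizer `R = (α, β, γ, δ)` with `m` input and `n`
output parameters is bounded by `k`, then the simplified regular resynchronizer `R'`
whose language is `γ' = ⋃ τ, γ(τ)` satisfies: `γ'` is regular, `R'` is bounded by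
`k·|Γ|·2ⁿ`, and `⟦R⟧ ⊆ ⟦R'⟧`; consequently any containment of sets of origin graphs
witnessed by a bounded extended regular resynchronizer is also witnessed by a bounded
simplified regular resynchronizer. -/
theorem ext_to_simplified (Sig Gam : Type) [Fintype Sig] [Fintype Gam] (m n k : ℕ)
    (R : ExtResync Sig Gam m n)
    (hα : IsRegularLang R.alpha) (hβ : IsRegularLang R.beta)
    (hγ : ∀ τ, IsRegularLang (R.gamma τ))
    (hδ : ∀ τ₁ τ₂, IsRegularLang (R.delta τ₁ τ₂))
    (hk : ExtBoundedBy R k) :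
    IsRegularLang (⋃ τ, R.gamma τ) ∧
    BoundedBy (⋃ τ, R.gamma τ) (k * Fintype.card Gam * 2 ^ n) ∧
    (∀ g g' : OriginGraph Sig Gam, ExtRel R g g' → ResyncRel (⋃ τ, R.gamma τ) g g') ∧
    (∀ S₁ S₂ : Set (OriginGraph Sig Gam),
      (∀ g₁ ∈ S₁, ∃ g₂ ∈ S₂, ExtRel R g₂ g₁) → ResyncLE S₁ S₂) := by
  have hreg := IsRegularLang.iUnion hγ
  have hbdd := hk.boundedBy_iUnion
  refine ⟨hreg, hbdd, fun _ _ h => h.resyncRel_iUnion, fun S₁ S₂ hS => ?_⟩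
  refine ⟨m, _, hreg, ⟨_, hbdd⟩, fun g₁ hg₁ => ?_⟩
  obtain ⟨g₂, hg₂, h⟩ := hS g₁ hg₁
  exact ⟨g₂, hg₂, h.resyncRel_iUnion⟩
end
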